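/- Fix integers n > m > 0. Let T_m be the (finite) set of taxi walks of length m starting at the origin, and for a taxi walk w of length n starting at the origin let head(w) ∈ T_m be its initial segment of length m and let tail(w) ∈ T_m be the image of its terminal segment of length m under the map f_{(x,y)}, where (x,y) is the initial vertex of that terminal segment. Let A(m,n) be the T_m × T_m matrix with nonnegative integer entries A(m,n)_{ij} = #{taxi walks w of length n from the origin with head(w) = i and tail(w) = j}. Then μ_taxi^{n−m} is at most the spectral radius of A(m,n); equivalently μ_taxi ≤ ρ(A(m,n))^{1/(n−m)}. -/

import Mathlib

open Filter

/-- The oriented step relation of the Manhattan lattice. -/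
def taxiStep (u v : ℤ × ℤ) : Prop :=
  (Even u.2 ∧ v = (u.1 + 1, u.2)) ∨
  (Odd u.2 ∧ v = (u.1 - 1, u.2)) ∨
  (Even u.1 ∧ v = (u.1, u.2 + 1)) ∨
  (Odd u.1 ∧ v = (u.1, u.2 - 1))

/-- Perpendicularity of two step vectors. -/
def perp (d e : ℤ × ℤ) : Prop := d.1 * e.1 + d.2 * e.2 = 0

instance (d e : ℤ × ℤ) : Decidable (perp d e) := by unfold perp; infer_instance

/-- The walk `l` turns at its `i`-th vertex (meaningful for `1 ≤ i ≤ l.length - 2`). -/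
def turnAt (l : List (ℤ × ℤ)) (i : ℕ) : Prop :=
  perp (l.getD i 0 - l.getD (i - 1) 0) (l.getD (i + 1) 0 - l.getD i 0)

instance (l : List (ℤ × ℤ)) (i : ℕ) : Decidable (turnAt l i) := by
  unfold turnAt; infer_instance

/-- A taxi walk, recorded as its list of vertices (a walk of length `n` has `n + 1` vertices). -/
def IsTaxiWalk (l : List (ℤ × ℤ)) : Prop :=
  l ≠ [] ∧ l.Nodup ∧
  (∀ i, i + 1 < l.length → taxiStep (l.getD i 0) (l.getD (i + 1) 0)) ∧
  (∀ i, 1 ≤ i → i + 2 < l.length → ¬(turnAt l i ∧ turnAt l (i + 1)))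

/-- The set of taxi walks of length `n` starting at the origin. -/
def originWalks (n : ℕ) : Set (List (ℤ × ℤ)) :=
  {l | IsTaxiWalk l ∧ l.length = n + 1 ∧ l.getD 0 0 = 0}

/-- `taxiCount n` is `c_n`, the number of taxi walks of length `n` starting at the origin. -/
noncomputable def taxiCount (n : ℕ) : ℕ := (originWalks n).ncard

/-- The turn-word of a walk: `true` (the letter `t`) where the walk turns,
`false` (the letter `s`) where it goes straight. -/
def turnWord (l : List (ℤ × ℤ)) : List Bool :=
  (List.range (l.length - 2)).map fun i => decide (turnAt l (i + 1))

/-- The encoding of a taxi walk starting at the origin: the first coordinate is `true`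
(for `N`) if `v₁ = (0,1)` and `false` (for `E`) if `v₁ = (1,0)`; the second is the turn-word. -/
def encode (l : List (ℤ × ℤ)) : Bool × List Bool :=
  (decide (l.getD 1 0 = (0, 1)), turnWord l)

/-- A bridge: a taxi walk from `(0,0)` to `(1,0)` staying at abscissa `≥ 1` after the start,
whose last step is horizontal and ends at maximal abscissa. -/
def IsBridge (l : List (ℤ × ℤ)) : Prop :=
  IsTaxiWalk l ∧ 2 ≤ l.length ∧ l.getD 0 0 = (0, 0) ∧ l.getD 1 0 = (1, 0) ∧
  (∀ i, 1 ≤ i → i < l.length → 1 ≤ (l.getD i 0).1) ∧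
  (l.getD (l.length - 1) 0).2 = (l.getD (l.length - 2) 0).2 ∧
  (∀ i, i < l.length → (l.getD i 0).1 ≤ (l.getD (l.length - 1) 0).1)

/-- `bridgeCount n` is `b_n`, the number of bridges of length `n`, with `b_0 = 1`. -/
noncomputable def bridgeCount : ℕ → ℕ
  | 0 => 1
  | n + 1 => {l : List (ℤ × ℤ) | IsBridge l ∧ l.length = n + 2}.ncard

/-- The normalizing symmetry `f_{(x,y)}` of the oriented Manhattan lattice. -/
def normMap (p : ℤ × ℤ) (q : ℤ × ℤ) : ℤ × ℤ :=
  if Even p.1 then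
    (if Even p.2 then (q.1 - p.1, q.2 - p.2) else (-(q.1 - p.1), q.2 - p.2))
  else
    (if Even p.2 then (q.1 - p.1, -(q.2 - p.2)) else (-(q.1 - p.1), -(q.2 - p.2)))

/-- The vertex `v_i` is a cutvertex of the bridge `l`. -/
def IsCutAt (l : List (ℤ × ℤ)) (i : ℕ) : Prop :=
  0 < i ∧ i + 1 < l.length ∧
  IsBridge (l.take (i + 1)) ∧
  l.getD (i + 1) 0 = l.getD i 0 + (1, 0) ∧
  IsBridge ((l.drop i).map (normMap (l.getD i 0)))

/-- An irreducible bridge: a bridge with no cutvertex. -/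
def IsIrreducibleBridge (l : List (ℤ × ℤ)) : Prop :=
  IsBridge l ∧ ∀ i, ¬ IsCutAt l i

/-- `irrBridgeCount n` is `a_n`, the number of irreducible bridges of length `n`, with `a_0 = 0`. -/
noncomputable def irrBridgeCount : ℕ → ℕ
  | 0 => 0
  | n + 1 => {l : List (ℤ × ℤ) | IsIrreducibleBridge l ∧ l.length = n + 2}.ncard

/-- The initial segment of length `m` of a walk (as a list of `m + 1` vertices). -/
def headSeg (m : ℕ) (l : List (ℤ × ℤ)) : List (ℤ × ℤ) := l.take (m + 1)

/-- The terminal segment of length `m` of a walk, normalized by the symmetry `f_{(x,y)}`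
where `(x,y)` is the initial vertex of that terminal segment. -/
def tailSeg (m : ℕ) (l : List (ℤ × ℤ)) : List (ℤ × ℤ) :=
  (l.drop (l.length - (m + 1))).map (normMap (l.getD (l.length - (m + 1)) 0))

/-- Alm's matrix `A(m,n)`, indexed by taxi walks of length `m` starting at the origin: the
`(i,j)` entry counts the taxi walks of length `n` from the origin whose initial segment of
length `m` is `i` and whose normalized terminal segment of length `m` is `j`. -/
noncomputable def almMatrix (m n : ℕ) :
    Matrix ↥(originWalks m) ↥(originWalks m) ℂ := fun i j =>
  ({l | l ∈ originWalks n ∧ headSeg m l = i.1 ∧ tailSeg m l = j.1}.ncard : ℂ)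

lemma perp_of_perp_normMap {p a b c d : ℤ × ℤ}
    (h : perp (normMap p a - normMap p b) (normMap p c - normMap p d)) :
    perp (a - b) (c - d) := by
  unfold perp normMap at *
  split_ifs at h <;> simp at h ⊢ <;> linarith

lemma normMap_injective (p : ℤ × ℤ) : Function.Injective (normMap p) := by
  rintro ⟨a, b⟩ ⟨c, d⟩ h
  unfold normMap at h
  split_ifs at h <;> simp at h ⊢ <;> omega

lemma normMap_self (p : ℤ × ℤ) : normMap p p = 0 := by
  unfold normMap; split_ifs <;> simp

lemma normMap_zero : normMap 0 = id := by
  funext q; simp [normMap]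

lemma normMap_normMap (p q r : ℤ × ℤ) :
    normMap (normMap p q) (normMap p r) = normMap q r := by
  obtain ⟨p1, p2⟩ := p
  obtain ⟨q1, q2⟩ := q
  obtain ⟨r1, r2⟩ := r
  simp only [normMap, Int.even_iff]
  split_ifs <;> simp only [Prod.mk.injEq] <;> omega

lemma taxiStep.normMap {u v : ℤ × ℤ} (p : ℤ × ℤ) (h : taxiStep u v) :
    taxiStep (normMap p u) (normMap p v) := by
  obtain ⟨p1, p2⟩ := p
  obtain ⟨u1, u2⟩ := u
  simp only [taxiStep, _root_.normMap, Int.even_iff, Int.odd_iff] at *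
  rcases h with ⟨h, rfl⟩ | ⟨h, rfl⟩ | ⟨h, rfl⟩ | ⟨h, rfl⟩ <;> split_ifs <;>
    simp only [Prod.mk.injEq, and_true, true_and] <;> omega

lemma getD_take {l : List (ℤ × ℤ)} {k i : ℕ} (h : i < k) :
    (l.take k).getD i 0 = l.getD i 0 := by
  simp [List.getD_eq_getElem?_getD, h]

lemma getD_map_drop {l : List (ℤ × ℤ)} {k i : ℕ} (f : ℤ × ℤ → ℤ × ℤ) (h : k + i < l.length) :
    ((l.drop k).map f).getD i 0 = f (l.getD (k + i) 0) := by
  rw [List.getD_eq_getElem _ _ (by simp; omega), List.getD_eq_getElem _ _ h]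
  simp

lemma take_mem_originWalks {l : List (ℤ × ℤ)} {N M : ℕ} (h : l ∈ originWalks N) (hM : M ≤ N) :
    l.take (M + 1) ∈ originWalks M := by
  obtain ⟨⟨-, hnd, hstep, hturn⟩, hlen, h0⟩ := h
  have hl : (l.take (M + 1)).length = M + 1 := by simp; omega
  refine ⟨⟨?_, hnd.sublist (List.take_sublist _ _), fun i hi => ?_, fun i hi hi' => ?_⟩, hl, ?_⟩
  · exact List.ne_nil_of_length_pos (by omega)
  · rw [getD_take (by omega), getD_take (by omega)]
    exact hstep i (by omega)
  · have := hturn i hi (by omega)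
    unfold turnAt at *
    rwa [getD_take (by omega), getD_take (by omega), getD_take (by omega), getD_take (by omega),
      getD_take (by omega)]
  · rwa [getD_take (by omega)]

lemma map_normMap_drop_mem_originWalks {l : List (ℤ × ℤ)} {N k M : ℕ} (h : l ∈ originWalks N)
    (hM : k + M = N) :
    (l.drop k).map (normMap (l.getD k 0)) ∈ originWalks M := by
  obtain ⟨⟨-, hnd, hstep, hturn⟩, hlen, h0⟩ := h
  have hl : ((l.drop k).map (normMap (l.getD k 0))).length = M + 1 := by simp; omega
  refine ⟨⟨?_, (hnd.sublist (List.drop_sublist _ _)).map (normMap_injective _),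
    fun i hi => ?_, fun i hi hi' => ?_⟩, hl, ?_⟩
  · exact List.ne_nil_of_length_pos (by omega)
  · rw [getD_map_drop _ (by omega), getD_map_drop _ (by omega)]
    exact (hstep (k + i) (by omega)).normMap _
  · have := hturn (k + i) (by omega) (by omega)
    unfold turnAt at *
    rw [getD_map_drop _ (by omega), getD_map_drop _ (by omega), getD_map_drop _ (by omega),
      getD_map_drop _ (by omega), getD_map_drop _ (by omega)]
    rw [Nat.add_sub_cancel, Nat.add_sub_assoc hi] at this
    exact fun ⟨h1, h2⟩ => this ⟨perp_of_perp_normMap h1, perp_of_perp_normMap h2⟩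
  · rw [getD_map_drop _ (by omega)]
    simp [normMap_self]

lemma finite_originWalks (N : ℕ) : (originWalks N).Finite := by
  induction N with
  | zero =>
    refine (Set.finite_singleton [0]).subset ?_
    rintro l ⟨-, hlen, h0⟩
    obtain ⟨a, rfl⟩ := List.length_eq_one_iff.1 hlen
    simpa using h0
  | succ N ih =>
    have hD : ({(1, 0), (-1, 0), (0, 1), (0, -1)} : Set (ℤ × ℤ)).Finite := by simp
    refine (Set.Finite.image2 (fun l d => l ++ [l.getD N 0 + d]) ih hD).subset ?_
    intro l hl
    refine ⟨l.take (N + 1), take_mem_originWalks hl (by omega),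
      l.getD (N + 1) 0 - l.getD N 0, ?_, ?_⟩
    · have := hl.1.2.2.1 N (by have := hl.2.1; omega)
      rcases this with ⟨-, h⟩ | ⟨-, h⟩ | ⟨-, h⟩ | ⟨-, h⟩ <;> rw [h] <;>
        simp [Prod.ext_iff]
    · have hlen := hl.2.1
      dsimp only
      rw [getD_take (by omega), add_sub_cancel, List.getD_eq_getElem _ _ (by omega),
        List.take_append_getElem, List.take_of_length_le (by omega)]

/-- The walks of length `N` from the origin with prescribed initial segment `i` and normalized
terminal segment `j`, both of length `m`. -/
def walksBetween (m N : ℕ) (i j : List (ℤ × ℤ)) : Set (List (ℤ × ℤ)) :=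
  {l | l ∈ originWalks N ∧ headSeg m l = i ∧ tailSeg m l = j}

lemma finite_walksBetween (m N : ℕ) (i j : List (ℤ × ℤ)) : (walksBetween m N i j).Finite :=
  (finite_originWalks N).subset fun _ h => h.1

lemma headSeg_mem {m N : ℕ} (h : m ≤ N) {l : List (ℤ × ℤ)} (hl : l ∈ originWalks N) :
    headSeg m l ∈ originWalks m :=
  take_mem_originWalks hl h

lemma tailSeg_mem {m N : ℕ} (h : m ≤ N) {l : List (ℤ × ℤ)} (hl : l ∈ originWalks N) :
    tailSeg m l ∈ originWalks m :=
  map_normMap_drop_mem_originWalks hl (by have := hl.2.1; omega)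

lemma taxiCount_le_sum (m N : ℕ) (h : m ≤ N) [Fintype ↥(originWalks m)] :
    taxiCount N ≤ ∑ i : ↥(originWalks m), ∑ j : ↥(originWalks m),
      (walksBetween m N i j).ncard := by
  have hsub : originWalks N ⊆ ⋃ i : ↥(originWalks m), ⋃ j : ↥(originWalks m),
      walksBetween m N i j := fun l hl => by
    simp only [Set.mem_iUnion]
    exact ⟨⟨_, headSeg_mem h hl⟩, ⟨_, tailSeg_mem h hl⟩, hl, rfl, rfl⟩
  refine (Set.ncard_le_ncard hsub (Set.finite_iUnion fun i => Set.finite_iUnion fun j =>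
    finite_walksBetween m N i j)).trans ?_
  refine (Set.ncard_iUnion_le_of_fintype _).trans (Finset.sum_le_sum fun i _ => ?_)
  exact Set.ncard_iUnion_le_of_fintype _

lemma ncard_walksBetween_add_le (m k L : ℕ) [Fintype ↥(originWalks m)] (i j : List (ℤ × ℤ)) :
    (walksBetween m (m + k + L) i j).ncard ≤ ∑ s : ↥(originWalks m),
      (walksBetween m (m + k) i s).ncard * (walksBetween m (m + L) s j).ncard := by
  have hsub : walksBetween m (m + k + L) i j ⊆ ⋃ s : ↥(originWalks m),
      {l ∈ walksBetween m (m + k + L) i j | tailSeg m (l.take (m + k + 1)) = s} := fun l hl => by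
    simp only [Set.mem_iUnion]
    exact ⟨⟨_, tailSeg_mem (by omega) (take_mem_originWalks hl.1 (M := m + k) (by omega))⟩, hl, rfl⟩
  have hfin := finite_walksBetween m (m + k + L) i j
  refine (Set.ncard_le_ncard hsub (Set.finite_iUnion fun s => hfin.subset fun l hl => hl.1)).trans ?_
  refine (Set.ncard_iUnion_le_of_fintype _).trans (Finset.sum_le_sum fun s _ => ?_)
  rw [← Set.ncard_prod]
  refine Set.ncard_le_ncard_of_injOn
    (fun l => (l.take (m + k + 1), (l.drop k).map (normMap (l.getD k 0)))) ?_ ?_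
    ((finite_walksBetween _ _ _ _).prod (finite_walksBetween _ _ _ _))
  · rintro l ⟨⟨hl, hi, hj⟩, hs⟩
    have hlen := hl.2.1
    have htake : (l.take (m + k + 1)).length = m + k + 1 := by simp; omega
    refine ⟨⟨take_mem_originWalks hl (by omega), ?_, hs⟩,
      ⟨map_normMap_drop_mem_originWalks hl (by omega), ?_, ?_⟩⟩
    · rw [← hi]
      simp only [headSeg, List.take_take]
      congr 1
      omega
    · rw [← hs]
      simp only [headSeg, tailSeg, htake]
      rw [getD_take (by omega), show m + k + 1 - (m + 1) = k by omega, ← List.map_take,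
        List.drop_take, show m + k + 1 - k = m + 1 by omega]
    · rw [← hj]
      simp only [tailSeg, List.length_map, List.length_drop, hlen]
      rw [getD_map_drop _ (by omega), ← List.map_drop, List.drop_drop, List.map_map,
        show k + (m + k + L + 1 - k - (m + 1)) = m + k + L + 1 - (m + 1) by omega]
      congr 1
      funext r
      exact normMap_normMap _ _ _
  · rintro l ⟨⟨hl, -⟩, -⟩ l' ⟨⟨hl', -⟩, -⟩ h
    simp only [Prod.mk.injEq] at h
    obtain ⟨h1, h2⟩ := h
    have hk : l.getD k 0 = l'.getD k 0 := by
      rw [← getD_take (k := m + k + 1) (by omega), h1, getD_take (by omega)]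
    rw [hk] at h2
    have h3 := List.map_injective_iff.2 (normMap_injective _) h2
    have h4 : l.take k = l'.take k := by
      have := congrArg (List.take k) h1
      simpa [List.take_take, show min k (m + k + 1) = k by omega] using this
    rw [← List.take_append_drop k l, h3, h4, List.take_append_drop]

lemma ncard_walksBetween_self_le (m : ℕ) (i j : ↥(originWalks m)) :
    (walksBetween m m i j).ncard ≤ (1 : Matrix ↥(originWalks m) ↥(originWalks m) ℕ) i j := by
  have key : ∀ l ∈ walksBetween m m i j, l = i.1 ∧ l = j.1 := by
    rintro l ⟨⟨-, hlen, h0⟩, hi, hj⟩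
    constructor
    · rw [← hi, headSeg, List.take_of_length_le hlen.le]
    · rw [← hj, tailSeg, hlen, Nat.sub_self, h0, normMap_zero]
      simp
  by_cases hij : i = j
  · subst hij
    rw [Matrix.one_apply_eq, ← Set.ncard_singleton i.1]
    exact Set.ncard_le_ncard (fun l hl => (key l hl).1) (Set.finite_singleton _)
  · have : walksBetween m m i j = ∅ := Set.eq_empty_of_forall_notMem fun l hl =>
      hij (Subtype.ext ((key l hl).1.symm.trans (key l hl).2))
    simp [this]

lemma ncard_walksBetween_le_pow (m L : ℕ) [Fintype ↥(originWalks m)] (k : ℕ)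
    (i j : ↥(originWalks m)) :
    (walksBetween m (m + k * L) i j).ncard ≤
      ((Matrix.of fun a b : ↥(originWalks m) => (walksBetween m (m + L) a b).ncard) ^ k) i j := by
  induction k generalizing j with
  | zero => simpa using ncard_walksBetween_self_le m i j
  | succ k ih =>
    rw [show m + (k + 1) * L = m + k * L + L by ring, pow_succ, Matrix.mul_apply]
    refine (ncard_walksBetween_add_le m (k * L) L i j).trans (Finset.sum_le_sum fun s _ => ?_)
    exact Nat.mul_le_mul_right _ (ih s)

open scoped Matrix.Norms.Operator in
lemma taxiCount_le_norm_pow (m L : ℕ) [Fintype ↥(originWalks m)] (k : ℕ) :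
    (taxiCount (m + k * L) : ℝ) ≤
      Fintype.card ↥(originWalks m) * ‖almMatrix m (m + L) ^ k‖ := by
  set B : Matrix ↥(originWalks m) ↥(originWalks m) ℕ :=
    Matrix.of fun a b => (walksBetween m (m + L) a b).ncard with hB
  have hA : almMatrix m (m + L) ^ k = (B ^ k).map (Nat.castRingHom ℂ) := by
    rw [Matrix.map_pow]
    rfl
  have h1 : taxiCount (m + k * L) ≤ ∑ i, ∑ j, (B ^ k) i j :=
    (taxiCount_le_sum m _ (by omega)).trans
      (Finset.sum_le_sum fun i _ => Finset.sum_le_sum fun j _ => ncard_walksBetween_le_pow m L k i j)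
  calc (taxiCount (m + k * L) : ℝ) ≤ ∑ i, ∑ j, ((B ^ k) i j : ℝ) := by exact_mod_cast h1
    _ ≤ ∑ i : ↥(originWalks m), ‖almMatrix m (m + L) ^ k‖ := by
      refine Finset.sum_le_sum fun i _ => ?_
      have h2 : ∑ j, ‖(almMatrix m (m + L) ^ k) i j‖₊ ≤ ‖almMatrix m (m + L) ^ k‖₊ := by
        rw [Matrix.linfty_opNNNorm_def]
        exact Finset.le_sup (f := fun i => ∑ j, ‖(almMatrix m (m + L) ^ k) i j‖₊)
          (Finset.mem_univ i)
      have h3 : ∑ j, ‖(almMatrix m (m + L) ^ k) i j‖ ≤ ‖almMatrix m (m + L) ^ k‖ := by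
        simpa only [NNReal.coe_sum, coe_nnnorm] using NNReal.coe_le_coe.2 h2
      refine le_trans (le_of_eq (Finset.sum_congr rfl fun j _ => ?_)) h3
      rw [hA]
      simp
    _ = _ := by simp

lemma tendsto_rpow_div_of_tendsto_rpow_inv {c : ℕ → ℝ} (hc : ∀ k, 0 ≤ c k) {μ : ℝ}
    (hμ : Tendsto (fun k : ℕ => c k ^ ((1 : ℝ) / (k : ℝ))) atTop (nhds μ))
    (m : ℕ) {L : ℕ} (hL : 0 < L) :
    Tendsto (fun k : ℕ => c (m + k * L) ^ ((1 : ℝ) / (k : ℝ))) atTop (nhds (μ ^ L)) := by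
  have hsub : Tendsto (fun k : ℕ => m + k * L) atTop atTop :=
    tendsto_atTop_mono (fun k => (Nat.le_mul_of_pos_right k hL).trans (Nat.le_add_left _ _))
      tendsto_id
  have hexp : Tendsto (fun k : ℕ => (m : ℝ) / k + L) atTop (nhds (L : ℝ)) := by
    simpa using (tendsto_const_div_atTop_nhds_zero_nat (m : ℝ)).add_const (L : ℝ)
  have h := (hμ.comp hsub).rpow hexp (Or.inr (by exact_mod_cast hL))
  rw [Real.rpow_natCast] at h
  refine h.congr' ?_
  filter_upwards [eventually_gt_atTop 0] with k hk
  have hk' : (k : ℝ) ≠ 0 := by positivity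
  have hL' : (0 : ℝ) < m + k * L := by positivity
  simp only [Function.comp_apply]
  rw [← Real.rpow_mul (hc _)]
  congr 1
  push_cast
  field_simp

/-- For `0 < m < n`, the taxi walk connective constant satisfies
`μ_taxi^{n−m} ≤ ρ(A(m,n))`, where `ρ` denotes the spectral radius. -/
theorem muTaxi_le_spectralRadius_almMatrix (m n : ℕ) (hm : 0 < m) (hmn : m < n)
    (μ : ℝ)
    (hμ : Filter.Tendsto (fun k : ℕ => (taxiCount k : ℝ) ^ ((1 : ℝ) / (k : ℝ)))
      Filter.atTop (nhds μ))
    [Fintype ↥(originWalks m)] :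
    ENNReal.ofReal (μ ^ (n - m)) ≤ spectralRadius ℂ (almMatrix m n) := by
  obtain ⟨L, hL, rfl⟩ : ∃ L, 0 < L ∧ n = m + L := ⟨n - m, by omega, by omega⟩
  rw [Nat.add_sub_cancel_left]
  open scoped Matrix.Norms.Operator in
  let A := almMatrix m (m + L)
  let C : ℝ := Fintype.card ↥(originWalks m) + 1
  have hC : 0 < C := by positivity
  have hgelfand := spectrum.pow_norm_pow_one_div_tendsto_nhds_spectralRadius A
  have hC1 : Tendsto (fun k : ℕ => ENNReal.ofReal (C ^ ((1 : ℝ) / k))) atTop (nhds 1) := by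
    have h := (tendsto_const_nhds (x := C)).rpow
      (tendsto_const_div_atTop_nhds_zero_nat (1 : ℝ)) (Or.inl hC.ne')
    simpa using ENNReal.tendsto_ofReal h
  have hmul := ENNReal.Tendsto.mul hC1 (Or.inl one_ne_zero) hgelfand (Or.inr ENNReal.one_ne_top)
  rw [one_mul] at hmul
  have hlhs := ENNReal.tendsto_ofReal (tendsto_rpow_div_of_tendsto_rpow_inv
    (c := fun k => (taxiCount k : ℝ)) (fun k => Nat.cast_nonneg _) hμ m hL)
  refine le_of_tendsto_of_tendsto' hlhs hmul fun k => ?_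
  rw [← ENNReal.ofReal_mul (by positivity), ← Real.mul_rpow hC.le (norm_nonneg _)]
  refine ENNReal.ofReal_le_ofReal (Real.rpow_le_rpow (Nat.cast_nonneg _) ?_ (by positivity))
  refine (taxiCount_le_norm_pow m L k).trans ?_
  exact mul_le_mul_of_nonneg_right (by simp [C]) (norm_nonneg _)
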